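/- Let A be a C*-algebra, let m ≥ 2, and let x, y ∈ Cu(A). Then: (iv) if y ≤ x and x ∧ ∞y = y, then wdiv_m(y) ≤ wdiv_m(x); (v) if (x_k) is an increasing sequence in Cu(A) with supremum x, then wdiv_m(x) ≤ sup_k wdiv_m(x_k). -/

import Mathlib

/-!
Common definitions: abstract Cuntz semigroups, divisibility, and C*-algebra notions
(nowhere scatteredness, σ-unitality, etc.) used to formalize the statements.
-/

open scoped MultiplierAlgebra ENNReal
open Filter Topology

noncomputable section

universe uu vv

/-- The (sequential) way-below relation `x ≪ y` (compact containment) in a partially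
ordered set: whenever an increasing sequence has a supremum lying above `y`, some term
of the sequence already lies above `x`. -/
def WayBelow {S : Type*} [PartialOrder S] (x y : S) : Prop :=
  ∀ f : ℕ → S, Monotone f → ∀ s : S, IsLUB (Set.range f) s → y ≤ s → ∃ n, x ≤ f n

/-- An abstract Cuntz semigroup (`Cu`-semigroup): a positively ordered abelian monoid in
which every increasing sequence has a supremum, every element is the supremum of a
`≪`-increasing sequence, addition preserves `≪`, and which satisfies the standard
axioms (O5) (almost algebraic order) and (O6) (almost Riesz decomposition), as well as
the existence of infima with idempotents `∞y = sup_n n•y` (all of these hold in the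
Cuntz semigroup of any C*-algebra). -/
class CuSemigroup (S : Type*) extends AddCommMonoid S, PartialOrder S where
  add_le_add' : ∀ a b : S, a ≤ b → ∀ c : S, c + a ≤ c + b
  zero_le' : ∀ x : S, 0 ≤ x
  exists_isLUB : ∀ f : ℕ → S, Monotone f → ∃ s : S, IsLUB (Set.range f) s
  exists_waybelow_seq : ∀ x : S, ∃ f : ℕ → S, Monotone f ∧
    (∀ n, WayBelow (f n) (f (n + 1))) ∧ IsLUB (Set.range f) x
  waybelow_add : ∀ {x y z w : S}, WayBelow x y → WayBelow z w → WayBelow (x + z) (y + w)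
  /-- axiom (O5) -/
  almost_algebraic : ∀ x' x y' y z : S, WayBelow x' x → WayBelow y' y → x + y ≤ z →
    ∃ c : S, y' ≤ c ∧ x' + c ≤ z ∧ z ≤ x + c
  /-- axiom (O6) -/
  almost_riesz : ∀ x' x y z : S, WayBelow x' x → x ≤ y + z →
    ∃ v w : S, v ≤ x ∧ v ≤ y ∧ w ≤ x ∧ w ≤ z ∧ x' ≤ v + w
  /-- `infty y = ∞·y = sup_n n•y` -/
  infty : S → S
  isLUB_infty : ∀ y : S, IsLUB (Set.range fun n : ℕ => n • y) (infty y)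
  /-- the infimum `x ⊓ ∞y`, which exists in the Cuntz semigroup of any C*-algebra -/
  meetInfty : S → S → S
  isGLB_meetInfty : ∀ x y : S, IsGLB {x, infty y} (meetInfty x y)

namespace CuDiv

variable {S : Type*} [CuSemigroup S]

/-- `x` is weakly `(m, n)`-divisible. -/
def IsWeaklyDivisible (m n : ℕ) (x : S) : Prop :=
  ∀ x' : S, WayBelow x' x → ∃ y : Fin n → S, x' ≤ ∑ j, y j ∧ ∀ j, m • y j ≤ x

/-- `x` is `(m, n)`-divisible. -/
def IsDivisible (m n : ℕ) (x : S) : Prop :=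
  ∀ x' : S, WayBelow x' x → ∃ y : S, x' ≤ n • y ∧ m • y ≤ x

/-- `x` is weakly `(m, ω)`-divisible. -/
def IsWeaklyOmegaDivisible (m : ℕ) (x : S) : Prop :=
  ∀ x' : S, WayBelow x' x → ∃ (n : ℕ) (y : Fin n → S), x' ≤ ∑ j, y j ∧ ∀ j, m • y j ≤ x

/-- `x` is `(m, ω)`-divisible. -/
def IsOmegaDivisible (m : ℕ) (x : S) : Prop :=
  ∀ x' : S, WayBelow x' x → ∃ (y : S) (n : ℕ), x' ≤ n • y ∧ m • y ≤ x

/-- `wdiv m x` is the least positive integer `n` such that `x` is weakly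
`(m,n)`-divisible, and `∞` if there is no such `n`. -/
def wdiv (m : ℕ) (x : S) : ℕ∞ :=
  sInf {N : ℕ∞ | ∃ n : ℕ, 1 ≤ n ∧ N = n ∧ IsWeaklyDivisible m n x}

/-- `Div m x` is the least positive integer `n` such that `x` is `(m,n)`-divisible,
and `∞` if there is no such `n`. -/
def Div (m : ℕ) (x : S) : ℕ∞ :=
  sInf {N : ℕ∞ | ∃ n : ℕ, 1 ≤ n ∧ N = n ∧ IsDivisible m n x}

/-- An element `x` is strongly soft if for every `x' ≪ x` there is `t` with
`x' + t ≤ x ≤ ∞t`. -/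
def StronglySoft (x : S) : Prop :=
  ∀ x' : S, WayBelow x' x → ∃ t : S, x' + t ≤ x ∧ x ≤ CuSemigroup.infty t

/-- The Cuntz semigroup characterization of the Global Glimm Property: every element is
`(m, ω)`-divisible for every `m`. -/
def GlobalGlimm (S : Type*) [CuSemigroup S] : Prop :=
  ∀ (m : ℕ) (x : S), IsOmegaDivisible m x

/-- `Cu(A)` is left-soft separative. -/
def LeftSoftSeparative (S : Type*) [CuSemigroup S] : Prop :=
  ∀ x y t : S, StronglySoft x → WayBelow (x + t) (y + t) →
    WayBelow t (CuSemigroup.infty y) → WayBelow t (CuSemigroup.infty x) → WayBelow x y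

/-- `Cu(A)` is weakly cancellative. -/
def WeaklyCancellative (S : Type*) [CuSemigroup S] : Prop :=
  ∀ x y z : S, WayBelow (x + z) (y + z) → WayBelow x y

/-- `Cu(A)` has covering dimension zero. -/
def CoveringDimZero (S : Type*) [CuSemigroup S] : Prop :=
  ∀ x' x y₁ y₂ : S, WayBelow x' x → WayBelow x (y₁ + y₂) →
    ∃ z₁ z₂ : S, z₁ ≤ y₁ ∧ z₂ ≤ y₂ ∧ x' ≤ z₁ + z₂ ∧ z₁ + z₂ ≤ x

end CuDiv

/-- A functional on a Cuntz semigroup: an additive, order preserving map to `ℝ≥0∞`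
preserving suprema of increasing sequences.  (By Elliott–Robert–Santiago, the
functionals on `Cu(A)` are exactly those induced by the lower semicontinuous
2-quasitraces on `A ⊗ K`.) -/
structure CuFunctional (S : Type*) [CuSemigroup S] where
  toFun : S → ℝ≥0∞
  map_zero' : toFun 0 = 0
  map_add' : ∀ x y : S, toFun (x + y) = toFun x + toFun y
  mono' : ∀ x y : S, x ≤ y → toFun x ≤ toFun y
  sup' : ∀ f : ℕ → S, Monotone f → ∀ s : S, IsLUB (Set.range f) s →
    toFun s = ⨆ n, toFun (f n)

instance {S : Type*} [CuSemigroup S] : CoeFun (CuFunctional S) fun _ => S → ℝ≥0∞ :=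
  ⟨CuFunctional.toFun⟩

namespace CuDiv

variable {S : Type*} [CuSemigroup S]

/-- `x <ₛ y` : there is `γ < 1` with `λ(x) ≤ γ·λ(y)` for every functional `λ`. -/
def FunctionalLT (x y : S) : Prop :=
  ∃ γ : ℝ≥0∞, γ < 1 ∧ ∀ lam : CuFunctional S, lam x ≤ γ * lam y

/-- `A` has `k`-comparison (stated on `Cu(A)`). -/
def KComparison (S : Type*) [CuSemigroup S] (k : ℕ) : Prop :=
  ∀ (x : S) (b : Fin (k + 1) → S), (∀ i, FunctionalLT x (b i)) → x ≤ ∑ i, b i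

/-- `A` has strict comparison (stated on `Cu(A)`, via functionals, which correspond to
the lower semicontinuous 2-quasitraces). -/
def StrictComparison (S : Type*) [CuSemigroup S] : Prop :=
  ∀ x y : S, FunctionalLT x y → x ≤ y

/-- The natural topology on the cone `F(Cu(A))` of functionals. -/
def functionalTopology (S : Type*) [CuSemigroup S] : TopologicalSpace (CuFunctional S) :=
  TopologicalSpace.generateFrom
    ({U | ∃ (x : S) (r : ℝ≥0∞), U = {lam : CuFunctional S | r < lam x}} ∪
      {U | ∃ (x' x : S) (r : ℝ≥0∞), WayBelow x' x ∧ U = {lam : CuFunctional S | lam x' < r}})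

/-- A lower semicontinuous affine function on the cone of functionals of `Cu(A)`,
i.e. an element of `L(F(Cu(A)))`. -/
def IsLscAffine (F : CuFunctional S → ℝ≥0∞) : Prop :=
  (letI := functionalTopology S; LowerSemicontinuous F) ∧
    (∀ lam mu nu : CuFunctional S, (∀ x, nu x = lam x + mu x) → F nu = F lam + F mu) ∧
    (∀ (r : ℝ≥0∞) (lam nu : CuFunctional S), (∀ x, nu x = r * lam x) → F nu = r * F lam)

/-- The rank map of `Cu(A)` is surjective: every lower semicontinuous affine function on
the cone of functionals is realized as the rank function `λ ↦ λ(x)` of an element. -/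
def SurjectiveRankMap (S : Type*) [CuSemigroup S] : Prop :=
  ∀ F : CuFunctional S → ℝ≥0∞, IsLscAffine F → ∃ y : S, ∀ lam : CuFunctional S, lam y = F lam

end CuDiv

/-! ### C*-algebra notions -/

section CStar

variable {B : Type*} [NonUnitalCStarAlgebra B]

/-- Positivity in a C*-algebra: `a` is positive iff it is of the form `star b * b`. -/
def CStarNonneg (a : B) : Prop := ∃ b : B, a = star b * b

/-- Cuntz subequivalence `a ≼ b` : `a = lim_n rₙ b rₙ*`. -/
def CuntzBelow (a b : B) : Prop :=
  ∃ r : ℕ → B, Tendsto (fun n => r n * b * star (r n)) atTop (𝓝 a)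

/-- Cuntz equivalence. -/
def CuntzEquiv (a b : B) : Prop := CuntzBelow a b ∧ CuntzBelow b a

/-- `A` is σ-unital: it has a countable (norm-bounded, positive) approximate unit. -/
def SigmaUnital (A : Type*) [NonUnitalCStarAlgebra A] : Prop :=
  ∃ e : ℕ → A, (∀ n, CStarNonneg (e n) ∧ ‖e n‖ ≤ 1) ∧
    ∀ a : A, Tendsto (fun n => e n * a) atTop (𝓝 a) ∧ Tendsto (fun n => a * e n) atTop (𝓝 a)

end CStar

/-- A closed two-sided (automatically star-closed) ideal of a C*-algebra. -/
structure ClosedTwoSidedIdealC (A : Type*) [NonUnitalCStarAlgebra A] where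
  carrier : NonUnitalStarSubalgebra ℂ A
  isClosed : IsClosed (carrier : Set A)
  mul_mem_left : ∀ a : A, ∀ x ∈ carrier, a * x ∈ carrier
  mul_mem_right : ∀ a : A, ∀ x ∈ carrier, x * a ∈ carrier

section Reps

variable {A : Type*} [NonUnitalCStarAlgebra A]
variable {H : Type*} [NormedAddCommGroup H] [InnerProductSpace ℂ H] [CompleteSpace H]

/-- A (topologically) irreducible representation of `A` on a Hilbert space `H`. -/
def IsIrreducibleRep (π : A →⋆ₙₐ[ℂ] (H →L[ℂ] H)) : Prop :=
  (∃ a : A, π a ≠ 0) ∧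
    ∀ K : Submodule ℂ H, IsClosed (K : Set H) → (∀ a : A, ∀ v ∈ K, π a v ∈ K) →
      K = ⊥ ∨ K = ⊤

end Reps

/-- `A` has a nonzero elementary ideal-quotient `J/I`, expressed via a surjection of a
closed two-sided ideal `J` of `A` onto the algebra of compact operators on a Hilbert
space (the kernel `I` of such a `*`-homomorphism is automatically a closed two-sided
ideal of `A`, and conversely any nonzero elementary ideal-quotient arises this way). -/
def HasNonzeroElementaryIdealQuotient (A : Type*) [NonUnitalCStarAlgebra A] : Prop :=
  ∃ (J : ClosedTwoSidedIdealC A) (H : Type) (_ : NormedAddCommGroup H)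
    (_ : InnerProductSpace ℂ H) (_ : CompleteSpace H)
    (ψ : J.carrier →⋆ₙₐ[ℂ] (H →L[ℂ] H)),
      Set.range ψ = {T : H →L[ℂ] H | IsCompactOperator ⇑T} ∧ ∃ x, ψ x ≠ 0

/-- A C*-algebra is nowhere scattered if no ideal-quotient of it is nonzero and
elementary. -/
def NowhereScattered (A : Type*) [NonUnitalCStarAlgebra A] : Prop :=
  ¬ HasNonzeroElementaryIdealQuotient A

/-- A C*-algebra is elementary if it is isomorphic to the algebra of compact operators
on some Hilbert space. -/
def IsElementaryCStar (A : Type*) [NonUnitalCStarAlgebra A] : Prop :=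
  ∃ (H : Type) (_ : NormedAddCommGroup H) (_ : InnerProductSpace ℂ H) (_ : CompleteSpace H)
    (ψ : A →⋆ₙₐ[ℂ] (H →L[ℂ] H)),
      Function.Injective ψ ∧ Set.range ψ = {T : H →L[ℂ] H | IsCompactOperator ⇑T}

/-- A C*-algebra is simple if it is nonzero and has no nontrivial closed two-sided
ideals. -/
def IsSimpleCStar (A : Type*) [NonUnitalCStarAlgebra A] : Prop :=
  (∃ a : A, a ≠ 0) ∧
    ∀ J : ClosedTwoSidedIdealC A, (J.carrier : Set A) = {0} ∨ (J.carrier : Set A) = Set.univ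

/-- Real rank zero: the invertible self-adjoint elements are dense in the self-adjoint
part of the minimal unitization. -/
def RealRankZero (A : Type*) [NonUnitalCStarAlgebra A] : Prop :=
  ∀ x : Unitization ℂ A, IsSelfAdjoint x →
    x ∈ closure {y : Unitization ℂ A | IsSelfAdjoint y ∧ IsUnit y}

/-- Stable rank one: the invertible elements are dense in the minimal unitization. -/
def StableRankOne (A : Type*) [NonUnitalCStarAlgebra A] : Prop :=
  ∀ x : Unitization ℂ A, x ∈ closure {y : Unitization ℂ A | IsUnit y}

section CP

variable {A B : Type*} [NonUnitalCStarAlgebra A] [NonUnitalCStarAlgebra B]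

/-- A linear map between C*-algebras is completely positive if all of its matrix
amplifications preserve positivity. -/
def IsCompletelyPositive (φ : A →ₗ[ℂ] B) : Prop :=
  ∀ (n : ℕ) (a : Matrix (Fin n) (Fin n) A), (∃ b : Matrix (Fin n) (Fin n) A, a = star b * b) →
    ∃ c : Matrix (Fin n) (Fin n) B, a.map ⇑φ = star c * c

/-- A completely positive contractive (c.p.c.) map. -/
def IsCPC (φ : A →ₗ[ℂ] B) : Prop :=
  IsCompletelyPositive φ ∧ ∀ a : A, ‖φ a‖ ≤ ‖a‖

/-- A map between C*-algebras has order zero if it preserves orthogonality of positive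
elements. -/
def IsOrderZero (φ : A →ₗ[ℂ] B) : Prop :=
  ∀ a b : A, CStarNonneg a → CStarNonneg b → a * b = 0 → φ a * φ b = 0

end CP

/-- `A` has nuclear dimension at most `k`: there are c.p.c. approximations of the
identity through finite dimensional C*-algebras in which the downwards maps are sums of
`k+1` c.p.c. order zero maps. -/
def NuclearDimLE (A : Type*) [NonUnitalCStarAlgebra A] (k : ℕ) : Prop :=
  ∀ (F : Finset A) (ε : ℝ), 0 < ε →
    ∃ (Fd : Type) (_ : NonUnitalCStarAlgebra Fd) (_ : FiniteDimensional ℂ Fd)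
      (ψ : A →ₗ[ℂ] Fd) (φ : Fin (k + 1) → (Fd →ₗ[ℂ] A)),
        IsCPC ψ ∧ (∀ i, IsCPC (φ i) ∧ IsOrderZero (φ i)) ∧
        ∀ a ∈ F, ‖(∑ i, φ i (ψ a)) - a‖ ≤ ε

section Prim

variable (A : Type*) [NonUnitalCStarAlgebra A]

/-- A primitive ideal: the kernel of an irreducible representation. -/
def IsPrimitiveIdeal {A : Type*} [NonUnitalCStarAlgebra A] (J : ClosedTwoSidedIdealC A) : Prop :=
  ∃ (H : Type) (_ : NormedAddCommGroup H) (_ : InnerProductSpace ℂ H) (_ : CompleteSpace H)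
    (π : A →⋆ₙₐ[ℂ] (H →L[ℂ] H)),
      IsIrreducibleRep π ∧ ∀ a : A, a ∈ J.carrier ↔ π a = 0

/-- The primitive ideal space of `A`. -/
def PrimIdealSpace := {J : ClosedTwoSidedIdealC A // IsPrimitiveIdeal J}

/-- The hull-kernel (Jacobson) topology on the primitive ideal space. -/
instance : TopologicalSpace (PrimIdealSpace A) :=
  TopologicalSpace.generateFrom {U | ∃ a : A, U = {P : PrimIdealSpace A | a ∉ P.1.carrier}}

/-- `A` has topological dimension zero: the primitive ideal space has a basis of
compact open sets. -/
def TopDimZero : Prop :=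
  ∃ 𝒷 : Set (Set (PrimIdealSpace A)), TopologicalSpace.IsTopologicalBasis 𝒷 ∧
    ∀ U ∈ 𝒷, IsCompact U ∧ IsOpen U

end Prim

section Proj

variable {B : Type*} [NonUnitalCStarAlgebra B]

/-- A projection in a C*-algebra. -/
def IsProjectionElem (p : B) : Prop := IsSelfAdjoint p ∧ p * p = p

/-- `B` contains an infinite projection: a projection which is Murray-von Neumann
equivalent to a proper subprojection of itself. -/
def HasInfiniteProjection (B : Type*) [NonUnitalCStarAlgebra B] : Prop :=
  ∃ p v : B, IsProjectionElem p ∧ star v * v = p ∧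
    p * (v * star v) = v * star v ∧ v * star v ≠ p

end Proj

/-! ### The Cuntz semigroup of a C*-algebra -/

/-- Padding a matrix by one extra row and column of zeros. -/
def matPad {A : Type*} [Zero A] {n : ℕ} (a : Matrix (Fin n) (Fin n) A) :
    Matrix (Fin (n + 1)) (Fin (n + 1)) A :=
  Matrix.of fun i j =>
    if h : (i : ℕ) < n ∧ (j : ℕ) < n then a ⟨i, h.1⟩ ⟨j, h.2⟩ else 0

/-- A witness that `S` is the Cuntz semigroup of the C*-algebra `A`: it provides a
stabilization `stab` of `A` (a model of `A ⊗ K`, described as the C*-completion of the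
union of the matrix algebras `Mₙ(A)`), together with the class map
`cls : (stab)₊ → S = Cu(A)` identifying `S` with the set of Cuntz equivalence classes of
positive elements of `A ⊗ K`, with order induced by Cuntz subequivalence, addition
induced by orthogonal (diagonal) addition, and with the compact containment relation
`≪` given by `x ≪ [a]` iff `x ≤ [(a - ε)₊]` for some `ε > 0`. -/
structure IsCuntzSemigroupOf (A : Type uu) [NonUnitalCStarAlgebra A]
    (S : Type vv) [CuSemigroup S] where
  stab : Type (max uu vv)
  [stabCStar : NonUnitalCStarAlgebra stab]
  matEmb : (n : ℕ) → (Matrix (Fin n) (Fin n) A →⋆ₙₐ[ℂ] stab)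
  matEmb_injective : ∀ n, Function.Injective (matEmb n)
  matEmb_compat : ∀ (n : ℕ) (a : Matrix (Fin n) (Fin n) A), matEmb (n + 1) (matPad a) = matEmb n a
  matEmb_dense : Dense (⋃ n, Set.range (matEmb n))
  cls : stab → S
  cls_zero : cls 0 = 0
  cls_surj : ∀ s : S, ∃ b : stab, CStarNonneg b ∧ cls b = s
  cls_le_iff : ∀ a b : stab, CStarNonneg a → CStarNonneg b → (cls a ≤ cls b ↔ CuntzBelow a b)
  cls_add_orth : ∀ a b : stab, CStarNonneg a → CStarNonneg b → a * b = 0 →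
    cls (a + b) = cls a + cls b
  exists_orth : ∀ a b : stab, CStarNonneg a → CStarNonneg b →
    ∃ a' b' : stab, CStarNonneg a' ∧ CStarNonneg b' ∧ a' * b' = 0 ∧
      cls a' = cls a ∧ cls b' = cls b
  waybelow_iff : ∀ (x : S) (a : stab), CStarNonneg a →
    (WayBelow x (cls a) ↔ ∃ ε : ℝ, 0 < ε ∧ x ≤ cls (cfcₙ (fun t : ℝ => max (t - ε) 0) a))

attribute [instance] IsCuntzSemigroupOf.stabCStar

/-- The Cuntz class `[a] ∈ Cu(A)` of an element `a` of `A` itself (via the canonical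
embedding `A ≅ M₁(A) ⊆ A ⊗ K`). -/
def IsCuntzSemigroupOf.clsA {A : Type*} [NonUnitalCStarAlgebra A] {S : Type*} [CuSemigroup S]
    (h : IsCuntzSemigroupOf A S) (a : A) : S :=
  h.cls (h.matEmb 1 (Matrix.of fun _ _ => a))

/-- `B` has a surjective rank map (every lower semicontinuous affine function on the
cone of functionals on `Cu(B)` is realized as a rank function). -/
def HasSurjectiveRankMap (B : Type*) [NonUnitalCStarAlgebra B] : Prop :=
  ∀ (S : Type) (inst : CuSemigroup S), IsCuntzSemigroupOf B S → CuDiv.SurjectiveRankMap S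

/-- The family of separable sub-C*-algebras of `A` having a surjective rank map. -/
def sepSurjRankFamily (A : Type*) [NonUnitalCStarAlgebra A] :
    Set (NonUnitalStarSubalgebra ℂ A) :=
  {B | ∃ _h : IsClosed (B : Set A),
    TopologicalSpace.SeparableSpace B ∧ HasSurjectiveRankMap B}

/-- The family of separable sub-C*-algebras of `A` with a surjective rank map is
σ-complete (closed under countable increasing unions) and cofinal (every separable
sub-C*-algebra is contained in a member). -/
def SepSurjRankFamilySigmaCompleteCofinal (A : Type*) [NonUnitalCStarAlgebra A] : Prop :=
  (∀ Bseq : ℕ → NonUnitalStarSubalgebra ℂ A, Monotone Bseq →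
    (∀ n, Bseq n ∈ sepSurjRankFamily A) →
      (⨆ n, Bseq n).topologicalClosure ∈ sepSurjRankFamily A) ∧
  (∀ C : NonUnitalStarSubalgebra ℂ A, IsClosed (C : Set A) →
    TopologicalSpace.SeparableSpace C → ∃ B ∈ sepSurjRankFamily A, C ≤ B)

end

section FunctionalCalculus

variable {B : Type*} [NonUnitalCStarAlgebra B]

lemma CStarNonneg.isSelfAdjoint {a : B} (ha : CStarNonneg a) : IsSelfAdjoint a := by
  obtain ⟨b, rfl⟩ := ha
  exact IsSelfAdjoint.star_mul_self b

lemma CStarNonneg.add {a b : B} (ha : CStarNonneg a) (hb : CStarNonneg b) :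
    CStarNonneg (a + b) := by
  let := CStarAlgebra.spectralOrder B
  have := CStarAlgebra.spectralOrderedRing B
  exact CStarAlgebra.nonneg_iff_eq_star_mul_self.mp
    (add_nonneg (CStarAlgebra.nonneg_iff_eq_star_mul_self.mpr ha)
      (CStarAlgebra.nonneg_iff_eq_star_mul_self.mpr hb))

lemma CStarNonneg.cfcₙ_of_nonneg {f : ℝ → ℝ} (hf : ∀ t, 0 ≤ f t) (a : B) :
    CStarNonneg (cfcₙ f a) := by
  let := CStarAlgebra.spectralOrder B
  have := CStarAlgebra.spectralOrderedRing B
  exact CStarAlgebra.nonneg_iff_eq_star_mul_self.mp (cfcₙ_nonneg fun t _ => hf t)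

open ContinuousMapZero in
/-- The functional calculus at orthogonal self-adjoint elements takes orthogonal values and is
additive. -/
lemma cfcₙ_mul_eq_zero_and_cfcₙ_add_of_mul_eq_zero {a b : B} (ha : IsSelfAdjoint a)
    (hb : IsSelfAdjoint b) (hab : a * b = 0) {f : ℝ → ℝ} (hf : Continuous f) (hf0 : f 0 = 0) :
    cfcₙ f a * cfcₙ f b = 0 ∧ cfcₙ f (a + b) = cfcₙ f a + cfcₙ f b := by
  have hba : b * a = 0 := by simpa [ha.star_eq, hb.star_eq] using congrArg star hab
  have hc : IsSelfAdjoint (a + b) := ha.add hb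
  let s : Set ℝ := quasispectrum ℝ a ∪ quasispectrum ℝ b ∪ quasispectrum ℝ (a + b)
  have hsa : quasispectrum ℝ a ⊆ s := fun t ht => Or.inl (Or.inl ht)
  have hsb : quasispectrum ℝ b ⊆ s := fun t ht => Or.inl (Or.inr ht)
  have hsc : quasispectrum ℝ (a + b) ⊆ s := fun t ht => Or.inr ht
  have : Fact ((0 : ℝ) ∈ s) := ⟨hsa (quasispectrum.zero_mem ℝ a)⟩
  have : CompactSpace s := isCompact_iff_compactSpace.mp
    (((NonUnitalContinuousFunctionalCalculus.isCompact_quasispectrum a).union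
      (NonUnitalContinuousFunctionalCalculus.isCompact_quasispectrum b)).union
      (NonUnitalContinuousFunctionalCalculus.isCompact_quasispectrum (a + b)))
  let φa := cfcₙHomSuperset ha hsa
  let φb := cfcₙHomSuperset hb hsb
  let φc := cfcₙHomSuperset hc hsc
  have ca : Continuous φa := cfcₙHomSuperset_continuous ha hsa
  have cb : Continuous φb := cfcₙHomSuperset_continuous hb hsb
  have cc : Continuous φc := cfcₙHomSuperset_continuous hc hsc
  have ia : φa (.id s) = a := cfcₙHomSuperset_id ha hsa
  have ib : φb (.id s) = b := cfcₙHomSuperset_id hb hsb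
  have ic : φc (.id s) = a + b := cfcₙHomSuperset_id hc hsc
  have orth_ab : ∀ g h, φa g * φb h = 0 := fun g h => by
    have h₁ : a * φb h = 0 := ContinuousMapZero.mul_nonUnitalStarAlgHom_apply_eq_zero φb a
      (by rw [ib, hab]) (by rw [map_star, ib, hb.star_eq, hab]) cb h
    exact ContinuousMapZero.nonUnitalStarAlgHom_apply_mul_eq_zero φa _
      (by rw [ia, h₁]) (by rw [map_star, ia, ha.star_eq, h₁]) ca g
  have orth_ba : ∀ g h, φb g * φa h = 0 := fun g h => by
    have h₁ : b * φa h = 0 := ContinuousMapZero.mul_nonUnitalStarAlgHom_apply_eq_zero φa b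
      (by rw [ia, hba]) (by rw [map_star, ia, ha.star_eq, hba]) ca h
    exact ContinuousMapZero.nonUnitalStarAlgHom_apply_mul_eq_zero φb _
      (by rw [ib, h₁]) (by rw [map_star, ib, hb.star_eq, h₁]) cb g
  have hadd : ∀ g, φc g = φa g + φb g := fun g => by
    induction g using ContinuousMapZero.induction_on_of_compact with
    | zero => simp
    | id => rw [ia, ib, ic]
    | star_id => rw [map_star, map_star, map_star, ia, ib, ic, star_add]
    | add g h hg hh => rw [map_add, map_add, map_add, hg, hh]; abel
    | mul g h hg hh =>
      rw [map_mul, map_mul, map_mul, hg, hh, add_mul, mul_add, mul_add, orth_ab, orth_ba]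
      simp
    | smul r g hg => rw [map_smul, map_smul, map_smul, hg, smul_add]
    | frequently g hg => exact hg.mem_of_closed <| isClosed_eq cc (ca.add cb)
  let F : ContinuousMapZero s ℝ := ⟨⟨fun t => f t, by fun_prop⟩, hf0⟩
  have ea : cfcₙ f a = φa F := cfcₙ_apply f a hf.continuousOn hf0 ha
  have eb : cfcₙ f b = φb F := cfcₙ_apply f b hf.continuousOn hf0 hb
  have ec : cfcₙ f (a + b) = φc F := cfcₙ_apply f (a + b) hf.continuousOn hf0 hc
  rw [ea, eb, ec]
  exact ⟨orth_ab F F, hadd F⟩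

end FunctionalCalculus

section WayBelow

variable {S : Type*} [PartialOrder S] {x y z : S}

lemma WayBelow.trans_le (h : WayBelow x y) (hyz : y ≤ z) : WayBelow x z :=
  fun f hf s hs hz => h f hf s hs (hyz.trans hz)

lemma WayBelow.of_le_of_wayBelow (hxy : x ≤ y) (h : WayBelow y z) : WayBelow x z :=
  fun f hf s hs hz => (h f hf s hs hz).imp fun _ hn => hxy.trans hn

lemma WayBelow.le (h : WayBelow x y) : x ≤ y := by
  obtain ⟨-, hn⟩ := h (fun _ => y) monotone_const y (by simp) le_rfl
  exact hn

end WayBelow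

namespace CuSemigroup

variable {S : Type*} [CuSemigroup S]

instance : IsOrderedAddMonoid S where
  add_le_add_left a b h c := by simpa only [add_comm _ c] using add_le_add' a b h c

lemma exists_wayBelow_between {x y : S} (h : WayBelow x y) :
    ∃ z, WayBelow x z ∧ WayBelow z y := by
  obtain ⟨g, hg, hgw, hgs⟩ := exists_waybelow_seq y
  obtain ⟨n, hn⟩ := h g hg y hgs le_rfl
  exact ⟨g (n + 1), .of_le_of_wayBelow hn (hgw n),
    (hgw (n + 1)).trans_le (hgs.1 ⟨n + 2, rfl⟩)⟩

end CuSemigroup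

namespace IsCuntzSemigroupOf

variable {A : Type*} [NonUnitalCStarAlgebra A] {S : Type*} [CuSemigroup S]

/-- Continuity of addition: an element way below `v + w` lies below `v' + w'` for some
`v' ≪ v` and `w' ≪ w`. -/
lemma exists_wayBelow_add (hS : IsCuntzSemigroupOf A S) {x v w : S} (h : WayBelow x (v + w)) :
    ∃ v' w', WayBelow v' v ∧ WayBelow w' w ∧ x ≤ v' + w' := by
  obtain ⟨a₀, ha₀, rfl⟩ := hS.cls_surj v
  obtain ⟨b₀, hb₀, rfl⟩ := hS.cls_surj w
  obtain ⟨a, b, ha, hb, hab, hac, hbc⟩ := hS.exists_orth a₀ b₀ ha₀ hb₀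
  rw [← hac, ← hbc] at h ⊢
  rw [← hS.cls_add_orth a b ha hb hab, hS.waybelow_iff _ _ (ha.add hb)] at h
  obtain ⟨ε, hε, hx⟩ := h
  have hnn : ∀ t : ℝ, 0 ≤ max (t - ε) 0 := fun t => le_max_right _ _
  obtain ⟨horth, hadd⟩ := cfcₙ_mul_eq_zero_and_cfcₙ_add_of_mul_eq_zero ha.isSelfAdjoint
    hb.isSelfAdjoint hab (f := fun t : ℝ => max (t - ε) 0) (by fun_prop) (by simp [hε.le])
  refine ⟨_, _, (hS.waybelow_iff _ a ha).mpr ⟨ε, hε, le_rfl⟩,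
    (hS.waybelow_iff _ b hb).mpr ⟨ε, hε, le_rfl⟩, ?_⟩
  rwa [← hS.cls_add_orth _ _ (.cfcₙ_of_nonneg hnn a) (.cfcₙ_of_nonneg hnn b) horth, ← hadd]

/-- Almost Riesz decomposition with respect to a finite sum. -/
lemma exists_le_sum (hS : IsCuntzSemigroupOf A S) {n : ℕ} (z : Fin n → S) {x' x : S}
    (h : WayBelow x' x) (hx : x ≤ ∑ j, z j) :
    ∃ v : Fin n → S, (∀ j, v j ≤ x) ∧ (∀ j, v j ≤ z j) ∧ x' ≤ ∑ j, v j := by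
  induction n generalizing x' x with
  | zero => exact ⟨z, nofun, nofun, h.le.trans hx⟩
  | succ n ih =>
    rw [Fin.sum_univ_succ] at hx
    obtain ⟨x'', h₁, h₂⟩ := CuSemigroup.exists_wayBelow_between h
    obtain ⟨v, w, hvx, hvz, hwx, hwz, hvw⟩ := CuSemigroup.almost_riesz x'' x _ _ h₂ hx
    obtain ⟨v', w', hv', hw', hle⟩ := hS.exists_wayBelow_add (h₁.trans_le hvw)
    obtain ⟨u, hux, huz, hu⟩ := ih (fun j => z j.succ) hw' hwz
    refine ⟨Fin.cons v u, Fin.cases hvx fun j => (hux j).trans hwx, Fin.cases hvz huz, ?_⟩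
    rw [Fin.sum_univ_succ]
    exact hle.trans (add_le_add hv'.le hu)

end IsCuntzSemigroupOf

namespace CuDiv

variable {S : Type*} [CuSemigroup S] {m n : ℕ} {x : S}

lemma IsWeaklyDivisible.mono {k : ℕ} (hnk : n ≤ k) (h : IsWeaklyDivisible m n x) :
    IsWeaklyDivisible m k x := by
  intro x' hx'
  obtain ⟨y, hy, hyx⟩ := h x' hx'
  obtain ⟨d, rfl⟩ := Nat.exists_eq_add_of_le hnk
  refine ⟨Fin.append y 0, by simpa [Fin.sum_univ_add] using hy, fun j => ?_⟩
  refine Fin.addCases (fun i => ?_) (fun i => ?_) j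
  · simpa using hyx i
  · simpa using CuSemigroup.zero_le' x

lemma wdiv_le_natCast_iff : wdiv m x ≤ n ↔ 1 ≤ n ∧ IsWeaklyDivisible m n x := by
  constructor
  · intro h
    obtain hs | hs := Set.eq_empty_or_nonempty
      {N : ℕ∞ | ∃ n : ℕ, 1 ≤ n ∧ N = n ∧ IsWeaklyDivisible m n x}
    · simp [wdiv, hs] at h
    · obtain ⟨k, hk, hkN, hkx⟩ := csInf_mem hs
      rw [wdiv, hkN, Nat.cast_le] at h
      exact ⟨hk.trans h, hkx.mono h⟩
  · rintro ⟨hn, h⟩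
    exact sInf_le ⟨n, hn, rfl, h⟩

/-- Weak divisibility passes to `y` when `y = x ⊓ ∞y`. -/
lemma IsWeaklyDivisible.of_meetInfty_eq {A : Type*} [NonUnitalCStarAlgebra A]
    (hS : IsCuntzSemigroupOf A S) {y : S} (hyx : y ≤ x) (hy : CuSemigroup.meetInfty x y = y)
    (h : IsWeaklyDivisible m n x) : IsWeaklyDivisible m n y := by
  intro y' hy'
  obtain ⟨y'', h₁, h₂⟩ := CuSemigroup.exists_wayBelow_between hy'
  obtain ⟨z, hz, hzx⟩ := h y'' (h₂.trans_le hyx)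
  obtain ⟨v, hvy, hvz, hv⟩ := hS.exists_le_sum z h₁ hz
  refine ⟨v, hv, fun j => ?_⟩
  have hglb := CuSemigroup.isGLB_meetInfty x y
  rw [hy] at hglb
  refine hglb.2 ?_
  rintro _ (rfl | rfl)
  · exact (nsmul_le_nsmul_right (hvz j) m).trans (hzx j)
  · exact (nsmul_le_nsmul_right ((hvy j).trans h₂.le) m).trans
      ((CuSemigroup.isLUB_infty y).1 ⟨m, rfl⟩)

lemma IsWeaklyDivisible.of_isLUB {f : ℕ → S} (hf : Monotone f) (hx : IsLUB (Set.range f) x)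
    (h : ∀ k, IsWeaklyDivisible m n (f k)) : IsWeaklyDivisible m n x := by
  intro x' hx'
  obtain ⟨x'', h₁, h₂⟩ := CuSemigroup.exists_wayBelow_between hx'
  obtain ⟨k, hk⟩ := h₂ f hf x hx le_rfl
  obtain ⟨y, hy, hyk⟩ := h k x' (h₁.trans_le hk)
  exact ⟨y, hy, fun j => (hyk j).trans (hx.1 ⟨k, rfl⟩)⟩

end CuDiv

/-- Lemma 3.3 (iv)-(v).  `wdiv` is monotone along `y ≤ x` with
`x ∧ ∞y = y`, and lower semicontinuous along increasing sequences. -/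
theorem wdiv_meetInfty_and_sup
    (A : Type) [NonUnitalCStarAlgebra A] (S : Type) [CuSemigroup S]
    (hS : IsCuntzSemigroupOf A S)
    (m : ℕ) (hm : 2 ≤ m) (x y : S) :
    (y ≤ x → CuSemigroup.meetInfty x y = y → CuDiv.wdiv m y ≤ CuDiv.wdiv m x) ∧
    (∀ f : ℕ → S, Monotone f → IsLUB (Set.range f) x →
      CuDiv.wdiv m x ≤ ⨆ k, CuDiv.wdiv m (f k)) := by
  refine ⟨fun hyx hy => ?_, fun f hf hx => ?_⟩
  · cases h : CuDiv.wdiv m x with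
    | top => exact le_top
    | coe n =>
      obtain ⟨hn, hdiv⟩ := CuDiv.wdiv_le_natCast_iff.mp h.le
      exact CuDiv.wdiv_le_natCast_iff.mpr ⟨hn, hdiv.of_meetInfty_eq hS hyx hy⟩
  · cases h : ⨆ k, CuDiv.wdiv m (f k) with
    | top => exact le_top
    | coe n =>
      have hk k := CuDiv.wdiv_le_natCast_iff.mp ((le_iSup (fun k => CuDiv.wdiv m (f k)) k).trans h.le)
      exact CuDiv.wdiv_le_natCast_iff.mpr ⟨(hk 0).1, .of_isLUB hf hx fun k => (hk k).2⟩
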